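/- Let n ≥ 2, p > n − 2, M > 0, V > 0 and D > 0. There exists a constant C > 0 depending only on n, p, M, V, D such that the following holds: for every bounded open convex set Ω ⊂ ℝⁿ with |Ω| = V and diam(Ω) = D, and every nonzero convex function u that is continuous on the closure of Ω, smooth (C^∞) in Ω, satisfies det D²u(x) = M·|u(x)|^p for all x ∈ Ω and u = 0 on ∂Ω, the Hessian D²u is Lebesgue integrable over Ω and ∫_Ω ‖D²u(x)‖ dx ≤ C · sup_{Ω} |u|, where ‖·‖ is the Hilbert–Schmidt (Frobenius) norm of a matrix. -/

import Mathlib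

open Metric MeasureTheory Real

/-- The Hessian matrix of `u : ℝⁿ → ℝ` at `x`, with entries the second partial
derivatives `∂²u/∂xᵢ∂xⱼ` computed via iterated Fréchet derivatives. -/
noncomputable def hessianMatrix {n : ℕ} (u : EuclideanSpace ℝ (Fin n) → ℝ)
    (x : EuclideanSpace ℝ (Fin n)) : Matrix (Fin n) (Fin n) ℝ :=
  Matrix.of fun i j =>
    fderiv ℝ (fun y => fderiv ℝ u y (EuclideanSpace.single j 1)) x (EuclideanSpace.single i 1)

/-- The determinant of the Hessian matrix, `det D²u(x)`. -/
noncomputable def hessianDet {n : ℕ} (u : EuclideanSpace ℝ (Fin n) → ℝ)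
    (x : EuclideanSpace ℝ (Fin n)) : ℝ := (hessianMatrix u x).det

open Filter Topology Matrix

section MatrixInequalities

variable {ι : Type*} [Fintype ι] [DecidableEq ι]

lemma Matrix.one_le_det_of_posSemidef_sub_one {A : Matrix ι ι ℝ} (h : (A - 1).PosSemidef) :
    1 ≤ A.det := by
  have hA : A.IsHermitian := by simpa using h.1.add Matrix.isHermitian_one
  rw [hA.det_eq_prod_eigenvalues]
  refine Finset.one_le_prod fun i => ?_
  have h1 := h.dotProduct_mulVec_nonneg (hA.eigenvectorBasis i).ofLp
  have h2 : star (hA.eigenvectorBasis i).ofLp ⬝ᵥ (hA.eigenvectorBasis i).ofLp = 1 := by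
    have := hA.eigenvectorBasis.orthonormal.1 i
    have h3 := real_inner_self_eq_norm_sq (hA.eigenvectorBasis i)
    rw [this, EuclideanSpace.inner_eq_star_dotProduct, dotProduct_comm] at h3
    simpa using h3
  rw [Matrix.sub_mulVec, hA.mulVec_eigenvectorBasis, Matrix.one_mulVec, dotProduct_sub,
    dotProduct_smul, h2] at h1
  simpa using h1

lemma Matrix.det_le_det_of_posDef_of_posSemidef_sub {A B : Matrix ι ι ℝ} (hA : A.PosDef)
    (h : (B - A).PosSemidef) : A.det ≤ B.det := by
  obtain ⟨R, hR⟩ : ∃ R : Matrix ι ι ℝ, A = Rᴴ * R := by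
    open scoped MatrixOrder Matrix.Norms.L2Operator in
    obtain ⟨R, hR⟩ := CStarAlgebra.nonneg_iff_eq_star_mul_self.mp hA.posSemidef.nonneg
    exact ⟨R, hR⟩
  have hdet : IsUnit R.det := by
    have := hA.det_pos
    rw [hR, det_mul] at this
    exact isUnit_iff_ne_zero.2 fun h0 => by simp [h0] at this
  have hRi : R * R⁻¹ = 1 := Matrix.mul_nonsing_inv R hdet
  have hRi' : R⁻¹ᴴ * Rᴴ = 1 := by rw [← Matrix.conjTranspose_mul, hRi, Matrix.conjTranspose_one]
  have hRi2 : R⁻¹ * R = 1 := Matrix.nonsing_inv_mul R hdet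
  have hRi2' : Rᴴ * R⁻¹ᴴ = 1 := by rw [← Matrix.conjTranspose_mul, hRi2, Matrix.conjTranspose_one]
  have h1 := h.conjTranspose_mul_mul_same R⁻¹
  have h2 : R⁻¹ᴴ * (B - A) * R⁻¹ = R⁻¹ᴴ * B * R⁻¹ - 1 := by
    rw [Matrix.mul_sub, Matrix.sub_mul, hR]
    congr 1
    rw [← Matrix.mul_assoc, hRi', Matrix.one_mul, hRi]
  rw [h2] at h1
  have h3 := Matrix.one_le_det_of_posSemidef_sub_one h1
  have h4 : B = Rᴴ * (R⁻¹ᴴ * B * R⁻¹) * R := by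
    rw [Matrix.mul_assoc, Matrix.mul_assoc, hRi2, Matrix.mul_one, ← Matrix.mul_assoc, hRi2',
      Matrix.one_mul]
  have h5 : B.det = A.det * (R⁻¹ᴴ * B * R⁻¹).det := by
    conv_lhs => rw [h4]
    rw [hR]
    simp only [det_mul]
    ring
  rw [h5]
  exact le_mul_of_one_le_right hA.det_pos.le h3

/-- A positive semidefinite matrix bounded above by `c` has determinant at most `c ^ n`. -/
lemma Matrix.det_le_pow_of_posSemidef {A : Matrix ι ι ℝ} (hA : A.PosSemidef) {c : ℝ} (hc : 0 ≤ c)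
    (h : ∀ v, v ⬝ᵥ A *ᵥ v ≤ c * (v ⬝ᵥ v)) : A.det ≤ c ^ Fintype.card ι := by
  by_cases h0 : A.det = 0
  · rw [h0]; positivity
  have hpd : A.PosDef := hA.posDef_iff_isUnit.2 ((isUnit_iff_isUnit_det A).2 (Ne.isUnit h0))
  have := Matrix.det_le_det_of_posDef_of_posSemidef_sub (B := c • (1 : Matrix ι ι ℝ)) hpd ?_
  · simpa using this
  · refine .of_dotProduct_mulVec_nonneg ?_ fun v => ?_
    · refine IsHermitian.sub ?_ hA.1
      simp [IsHermitian]
    · simpa [Matrix.sub_mulVec, dotProduct_sub, Matrix.smul_mulVec] using h v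

/-- A matrix bounded below by `a + b w wᵀ`, with `w` a unit vector, has determinant at least
`a ^ (n - 1) * b`. -/
lemma Matrix.pow_mul_le_det {A : Matrix ι ι ℝ} (hA : A.IsHermitian) {a b : ℝ} (ha : 0 < a)
    (hb : 0 < b) {w : ι → ℝ} (hw : w ⬝ᵥ w = 1)
    (h : ∀ v, a * (v ⬝ᵥ v) + b * (w ⬝ᵥ v) ^ 2 ≤ v ⬝ᵥ A *ᵥ v) :
    a ^ (Fintype.card ι - 1) * b ≤ A.det := by
  have hcard : Fintype.card ι ≠ 0 := by
    intro h0
    have := Fintype.card_eq_zero_iff.1 h0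
    simp [dotProduct] at hw
  set P : Matrix ι ι ℝ := a • 1 + b • vecMulVec w w with hP
  have hPv : ∀ v, v ⬝ᵥ P *ᵥ v = a * (v ⬝ᵥ v) + b * (w ⬝ᵥ v) ^ 2 := fun v => by
    simp only [hP, Matrix.add_mulVec, Matrix.smul_mulVec, Matrix.one_mulVec, dotProduct_add,
      dotProduct_smul, Matrix.vecMulVec_mulVec, smul_eq_mul, dotProduct_comm v w,
      MulOpposite.smul_eq_mul_unop, MulOpposite.unop_op]
    simp [sq]
  have hPh : P.IsHermitian := by
    ext i j
    simp [hP, vecMulVec, Matrix.one_apply, mul_comm, eq_comm]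
  have hPd : P.PosDef := by
    refine .of_dotProduct_mulVec_pos hPh fun v hv => ?_
    have : 0 < v ⬝ᵥ v := by simpa using Matrix.dotProduct_star_self_pos_iff.2 hv
    rw [star_trivial, hPv]
    positivity
  have hle := Matrix.det_le_det_of_posDef_of_posSemidef_sub hPd (B := A) <|
    .of_dotProduct_mulVec_nonneg (hA.sub hPh) fun v => by
      rw [star_trivial, Matrix.sub_mulVec, dotProduct_sub, hPv]
      linarith [h v]
  refine le_trans ?_ hle
  have hPe : P = a • (1 + replicateCol Unit ((b / a) • w) * replicateRow Unit w) := by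
    ext i j
    simp [hP, vecMulVec, Matrix.mul_apply]
    field_simp
  rw [hPe, det_smul, det_one_add_replicateCol_mul_replicateRow, dotProduct_smul, hw]
  obtain ⟨k, hk⟩ := Nat.exists_eq_succ_of_ne_zero hcard
  rw [hk]
  have : 0 < a ^ k := by positivity
  simp only [Nat.succ_eq_add_one, Nat.add_sub_cancel, pow_succ, smul_eq_mul, mul_one]
  have : a ^ k * a * (1 + b / a) = a ^ k * b + a ^ k * a := by field_simp; ring
  rw [this]
  have : 0 < a ^ k * a := by positivity
  linarith

/-- The Frobenius norm of a positive semidefinite matrix is controlled by its trace. -/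
lemma Matrix.sqrt_sum_sq_le_card_mul_trace {A : Matrix ι ι ℝ} (hA : A.PosSemidef) :
    √(∑ i, ∑ j, A i j ^ 2) ≤ Fintype.card ι * A.trace := by
  have hsym : ∀ i j, A j i = A i j := fun i j => by simpa using hA.1.apply i j
  have hij : ∀ i j, |A i j| ≤ (A i i + A j j) / 2 := fun i j => by
    have h1 := hA.dotProduct_mulVec_nonneg (Pi.single i 1 + Pi.single j 1)
    have h2 := hA.dotProduct_mulVec_nonneg (Pi.single i 1 - Pi.single j 1)
    simp [Matrix.mulVec_add, Matrix.mulVec_sub, add_dotProduct, sub_dotProduct, hsym i j] at h1 h2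
    rw [abs_le]
    constructor <;> linarith [hsym i j]
  calc √(∑ i, ∑ j, A i j ^ 2) ≤ ∑ i, ∑ j, |A i j| := by
        refine Real.sqrt_le_iff.2 ⟨by positivity, ?_⟩
        rw [← Finset.sum_product', ← Finset.sum_product']
        simpa using Finset.sum_sq_le_sq_sum_of_nonneg
          (s := Finset.univ ×ˢ Finset.univ) (f := fun x : ι × ι => |A x.1 x.2|)
          (fun _ _ => abs_nonneg _)
    _ ≤ ∑ i, ∑ j, (A i i + A j j) / 2 := by gcongr; exact hij _ _
    _ = Fintype.card ι * A.trace := by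
        simp only [add_div, Finset.sum_add_distrib, Finset.sum_const, Finset.card_univ,
          nsmul_eq_mul, Matrix.trace, Matrix.diag, ← Finset.sum_div, ← Finset.mul_sum]
        ring

end MatrixInequalities

section SecondDerivative

lemma nonneg_of_isLocalMin_of_hasDerivAt {f f' : ℝ → ℝ} {c a : ℝ}
    (h : ∀ᶠ s in 𝓝 a, HasDerivAt f (f' s) s) (h' : HasDerivAt f' c a) (hmin : IsLocalMin f a) :
    0 ≤ c := by
  by_contra! hc
  have hd : deriv f =ᶠ[𝓝 a] f' := h.mono fun s hs => hs.deriv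
  have hmax : IsLocalMax f a := by
    refine isLocalMax_of_deriv_deriv_neg ?_ hmin.deriv_eq_zero h.self_of_nhds.continuousAt
    rwa [hd.deriv_eq, h'.deriv]
  have hconst : f =ᶠ[𝓝 a] fun _ => f a := by
    filter_upwards [hmin, hmax] with s h1 h2 using le_antisymm h2 h1
  have hz : deriv f =ᶠ[𝓝 a] fun _ => 0 := by simpa using hconst.deriv
  have : c = 0 := by
    rw [← h'.deriv, ← hd.deriv_eq, hz.deriv_eq, deriv_const]
  exact hc.ne this

variable {n : ℕ} {u : EuclideanSpace ℝ (Fin n) → ℝ} {x : EuclideanSpace ℝ (Fin n)}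

lemma ContDiffAt.differentiableAt_fderiv (hu : ContDiffAt ℝ 2 u x) :
    DifferentiableAt ℝ (fderiv ℝ u) x :=
  (hu.fderiv_right (m := 1) (by norm_num)).differentiableAt (by norm_num)

lemma hessianMatrix_apply (hu : ContDiffAt ℝ 2 u x) (i j : Fin n) :
    hessianMatrix u x i j = fderiv ℝ (fderiv ℝ u) x (EuclideanSpace.single i 1)
      (EuclideanSpace.single j 1) := by
  have h := hu.differentiableAt_fderiv.hasFDerivAt.clm_apply
    (hasFDerivAt_const (EuclideanSpace.single j (1 : ℝ)) x)
  simp [hessianMatrix, h.fderiv]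

lemma dotProduct_hessianMatrix_mulVec (hu : ContDiffAt ℝ 2 u x) (d : EuclideanSpace ℝ (Fin n)) :
    d.ofLp ⬝ᵥ hessianMatrix u x *ᵥ d.ofLp = fderiv ℝ (fderiv ℝ u) x d d := by
  have hd : d = ∑ i, d i • EuclideanSpace.single i (1 : ℝ) := by
    ext j; simp [Finset.sum_apply, Pi.single_apply]
  conv_rhs => rw [hd]
  simp only [map_sum, map_smul, _root_.sum_apply, _root_.smul_apply,
    dotProduct, Matrix.mulVec, hessianMatrix_apply hu, smul_eq_mul, Finset.mul_sum]
  rw [Finset.sum_comm]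
  refine Finset.sum_congr rfl fun i _ => Finset.sum_congr rfl fun j _ => by ring

lemma isHermitian_hessianMatrix (hu : ContDiffAt ℝ 2 u x) : (hessianMatrix u x).IsHermitian := by
  ext i j
  rw [Matrix.conjTranspose_apply, star_trivial, hessianMatrix_apply hu, hessianMatrix_apply hu]
  exact (hu.isSymmSndFDerivAt (by simp)).eq _ _

lemma hasDerivAt_comp_line (hu : ContDiffAt ℝ 2 u x) (d : EuclideanSpace ℝ (Fin n)) :
    ∀ᶠ s in 𝓝 (0 : ℝ), HasDerivAt (fun s : ℝ => u (x + s • d)) (fderiv ℝ u (x + s • d) d) s := by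
  have hev : ∀ᶠ y in 𝓝 x, DifferentiableAt ℝ u y :=
    (hu.eventually (by simp)).mono fun y hy => hy.differentiableAt (by simp)
  have hc : Tendsto (fun s : ℝ => x + s • d) (𝓝 0) (𝓝 x) := by
    have : Continuous fun s : ℝ => x + s • d := by fun_prop
    simpa using this.tendsto 0
  filter_upwards [hc.eventually hev] with s hs
  have h1 : HasDerivAt (fun s : ℝ => x + s • d) d s := by
    simpa using ((hasDerivAt_id s).smul_const d).const_add x
  exact hs.hasFDerivAt.comp_hasDerivAt s h1

lemma hasDerivAt_fderiv_comp_line (hu : ContDiffAt ℝ 2 u x) (d : EuclideanSpace ℝ (Fin n)) :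
    HasDerivAt (fun s : ℝ => fderiv ℝ u (x + s • d) d)
      (d.ofLp ⬝ᵥ hessianMatrix u x *ᵥ d.ofLp) 0 := by
  rw [dotProduct_hessianMatrix_mulVec hu]
  have h1 : HasDerivAt (fun s : ℝ => x + s • d) d 0 := by
    simpa using ((hasDerivAt_id (0 : ℝ)).smul_const d).const_add x
  have h2 : HasFDerivAt (fderiv ℝ u) (fderiv ℝ (fderiv ℝ u) x) (x + (0 : ℝ) • d) := by
    simpa using hu.differentiableAt_fderiv.hasFDerivAt
  have h3 := h2.clm_apply (hasFDerivAt_const d (x + (0 : ℝ) • d))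
  refine (h3.comp_hasDerivAt (0 : ℝ) h1).congr_deriv ?_
  simp

lemma le_hessianMatrix_of_isLocalMin (hu : ContDiffAt ℝ 2 u x) (d : EuclideanSpace ℝ (Fin n))
    {g g' : ℝ → ℝ} {c : ℝ} (hg : ∀ᶠ s in 𝓝 0, HasDerivAt g (g' s) s) (hg' : HasDerivAt g' c 0)
    (hmin : IsLocalMin (fun s : ℝ => u (x + s • d) - g s) 0) :
    c ≤ d.ofLp ⬝ᵥ hessianMatrix u x *ᵥ d.ofLp := by
  have := nonneg_of_isLocalMin_of_hasDerivAt
    ((hasDerivAt_comp_line hu d).and hg |>.mono fun s hs => hs.1.sub hs.2)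
    ((hasDerivAt_fderiv_comp_line hu d).sub hg') hmin
  linarith

lemma hessianMatrix_le_of_isLocalMax (hu : ContDiffAt ℝ 2 u x) (d : EuclideanSpace ℝ (Fin n))
    {g g' : ℝ → ℝ} {c : ℝ} (hg : ∀ᶠ s in 𝓝 0, HasDerivAt g (g' s) s) (hg' : HasDerivAt g' c 0)
    (hmax : IsLocalMax (fun s : ℝ => u (x + s • d) - g s) 0) :
    d.ofLp ⬝ᵥ hessianMatrix u x *ᵥ d.ofLp ≤ c := by
  have := nonneg_of_isLocalMin_of_hasDerivAt
    ((hasDerivAt_comp_line hu d).and hg |>.mono fun s hs => hs.2.sub hs.1)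
    (hg'.sub (hasDerivAt_fderiv_comp_line hu d)) (by
      refine hmax.neg.congr (Eventually.of_forall fun s => ?_)
      simp)
  linarith

lemma posSemidef_hessianMatrix {Ω : Set (EuclideanSpace ℝ (Fin n))} (hΩ : IsOpen Ω)
    (hu : ContDiffAt ℝ 2 u x) (hx : x ∈ Ω) (hc : ConvexOn ℝ Ω u) :
    (hessianMatrix u x).PosSemidef := by
  refine .of_dotProduct_mulVec_nonneg (isHermitian_hessianMatrix hu) fun v => ?_
  rw [star_trivial]
  set d : EuclideanSpace ℝ (Fin n) := WithLp.toLp 2 v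
  have hd1 := hasDerivAt_comp_line hu d
  have hd2 := hasDerivAt_comp_line hu (-d)
  have hs1 := hasDerivAt_fderiv_comp_line hu d
  have hs2 := hasDerivAt_fderiv_comp_line hu (-d)
  have := nonneg_of_isLocalMin_of_hasDerivAt (hd1.and hd2 |>.mono fun s hs => hs.1.add hs.2)
    (hs1.add hs2) ?_
  · simp only [WithLp.ofLp_neg, Matrix.mulVec_neg, dotProduct_neg, neg_dotProduct, neg_neg] at this
    change 0 ≤ d.ofLp ⬝ᵥ hessianMatrix u x *ᵥ d.ofLp
    linarith
  · have hm : ∀ e : EuclideanSpace ℝ (Fin n), ∀ᶠ s in 𝓝 (0 : ℝ), x + s • e ∈ Ω := fun e => by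
      have : Continuous fun s : ℝ => x + s • e := by fun_prop
      exact this.continuousAt.eventually (by simpa using hΩ.mem_nhds hx)
    filter_upwards [hm d, hm (-d)] with s h1 h2
    have := hc.2 h1 h2 (show (0 : ℝ) ≤ 1 / 2 by norm_num) (show (0 : ℝ) ≤ 1 / 2 by norm_num)
      (by norm_num)
    have he : (1 / 2 : ℝ) • (x + s • d) + (1 / 2 : ℝ) • (x + s • -d) = x := by module
    rw [he] at this
    simp only [smul_eq_mul, Pi.add_apply, zero_smul, add_zero] at this ⊢
    linarith

end SecondDerivative

section ConvexGeometry

open scoped ENNReal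

variable {n : ℕ} {Ω : Set (EuclideanSpace ℝ (Fin n))} {D : ℝ}

/-- The points of a convex set which leave it under a translation by `h • e` occupy a small volume:
many translates of this set by multiples of `h • e` are pairwise disjoint. -/
lemma natCast_mul_volume_exit_le (hΩ : IsOpen Ω) (hb : Bornology.IsBounded Ω) (hc : Convex ℝ Ω)
    (hD : 0 < D) (hdiam : Metric.diam Ω = D) {e : EuclideanSpace ℝ (Fin n)} (he : ‖e‖ = 1)
    {N : ℕ} (hN : 0 < N) :
    (N : ℝ≥0∞) * volume {x ∈ Ω | x + (D / N) • e ∉ Ω} ≤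
      volume (closedBall (0 : EuclideanSpace ℝ (Fin n)) (2 * D)) := by
  set κ := D / N with hκ
  have hκ0 : 0 < κ := by positivity
  set F := {x ∈ Ω | x + κ • e ∉ Ω} with hF
  have hFm : MeasurableSet F := by
    refine hΩ.measurableSet.inter (MeasurableSet.compl ?_)
    exact (hΩ.preimage (f := fun x => x + κ • e) (by fun_prop)).measurableSet
  rcases Ω.eq_empty_or_nonempty with h0 | ⟨x₀, hx₀⟩
  · simp [hF, h0]
  let T : ℕ → Set (EuclideanSpace ℝ (Fin n)) := fun j => (fun y => y + -((j * κ) • e)) ⁻¹' F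
  have hTv : ∀ j, volume (T j) = volume F := fun j => measure_preimage_add_right _ _ _
  have hTm : ∀ j, MeasurableSet (T j) := fun j => hFm.preimage (by fun_prop)
  have key : ∀ j k : ℕ, j < k → Disjoint (T j) (T k) := fun j k hjk => by
    rw [Set.disjoint_left]
    intro y hj hk
    have hj' : y + -((j * κ) • e) ∈ Ω := hj.1
    refine hk.2 ?_
    have hk' : y + -((k * κ) • e) ∈ Ω := hk.1
    have h1 : (1 : ℝ) ≤ k - j := by
      have : (j : ℝ) + 1 ≤ k := by exact_mod_cast hjk
      linarith
    have := hc.add_smul_sub_mem hk' hj' (t := 1 / (k - j))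
      ⟨by positivity, by rw [div_le_one (by linarith)]; exact h1⟩
    convert this using 2
    have h2 : y + -((j * κ) • e) - (y + -((k * κ) • e)) = ((k - j : ℝ) * κ) • e := by module
    rw [h2, smul_smul]
    congr 1
    have : (k - j : ℝ) ≠ 0 := by linarith
    field_simp
  have hdisj : (↑(Finset.range N) : Set ℕ).PairwiseDisjoint T := fun j _ k _ hjk =>
    (lt_or_gt_of_ne hjk).elim (key j k) fun h => (key k j h).symm
  have hsum := measure_biUnion_finset hdisj (μ := volume) fun j _ => hTm j
  simp only [hTv, Finset.sum_const, Finset.card_range, nsmul_eq_mul] at hsum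
  rw [← hsum, ← Measure.addHaar_closedBall_center volume x₀]
  refine measure_mono (Set.iUnion₂_subset fun j hj y hy => ?_)
  have hy' : y + -((j * κ) • e) ∈ Ω := hy.1
  have h1 := Metric.dist_le_diam_of_mem hb hy' hx₀
  rw [hdiam] at h1
  have hjN : (j : ℝ) ≤ N := by exact_mod_cast (Finset.mem_range.1 hj).le
  have h2 : dist y (y + -((j * κ) • e)) ≤ D := by
    rw [dist_self_add_right, norm_neg, norm_smul, he, mul_one, Real.norm_of_nonneg (by positivity),
      hκ]
    have : (0 : ℝ) < N := by positivity
    calc (j : ℝ) * (D / N) ≤ N * (D / N) := by gcongr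
      _ = D := by field_simp
  rw [mem_closedBall]
  linarith [dist_triangle y (y + -((j * κ) • e)) x₀]

lemma Convex.ball_subset_of_forall_single_mem (hc : Convex ℝ Ω) (hn : 0 < n)
    {x : EuclideanSpace ℝ (Fin n)} {κ : ℝ} (hκ : 0 < κ)
    (h₁ : ∀ i, x + κ • EuclideanSpace.single i (1 : ℝ) ∈ Ω)
    (h₂ : ∀ i, x + κ • -EuclideanSpace.single i (1 : ℝ) ∈ Ω) :
    ball x (κ / n) ⊆ Ω := by
  intro z hz
  have hn' : (0 : ℝ) < n := by exact_mod_cast hn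
  have hz' : z = ∑ i : Fin n, (1 / n : ℝ) • (x + (n * (z - x) i) • EuclideanSpace.single i (1 : ℝ)) := by
    ext j
    simp [Finset.sum_apply, Pi.single_apply, Finset.sum_add_distrib]
    field_simp
    ring
  rw [hz']
  refine hc.sum_mem (fun _ _ => by positivity) (by simp; field_simp) fun i _ => ?_
  have hzi : |(z - x) i| ≤ κ / n := by
    rw [mem_ball, dist_eq_norm] at hz
    exact (PiLp.norm_apply_le (z - x) i).trans hz.le
  have hci : |n * (z - x) i| ≤ κ := by
    rw [abs_mul, abs_of_pos hn']
    calc (n : ℝ) * |(z - x) i| ≤ n * (κ / n) := by gcongr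
      _ = κ := by field_simp
  have := hc.add_smul_sub_mem (h₂ i) (h₁ i) (t := (n * (z - x) i + κ) / (2 * κ))
    ⟨by rw [abs_le] at hci; exact div_nonneg (by linarith) (by linarith),
      by rw [abs_le] at hci; rw [div_le_one (by linarith)]; linarith⟩
  convert this using 1
  have h2 : x + κ • EuclideanSpace.single i (1 : ℝ) - (x + κ • -EuclideanSpace.single i (1 : ℝ)) =
    (2 * κ) • EuclideanSpace.single i (1 : ℝ) := by module
  rw [h2, smul_smul, div_mul_cancel₀ _ (by positivity)]
  module

/-- A convex set of given volume and diameter contains a ball of controlled radius. -/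
lemma exists_ball_subset_of_volume_of_diam (hn : 0 < n) {V : ℝ} (hV : 0 < V) (hD : 0 < D) :
    ∃ r : ℝ, 0 < r ∧ ∀ Ω : Set (EuclideanSpace ℝ (Fin n)), IsOpen Ω → Bornology.IsBounded Ω →
      Convex ℝ Ω → volume Ω = ENNReal.ofReal V → Metric.diam Ω = D → ∃ y, ball y r ⊆ Ω := by
  set W := volume (closedBall (0 : EuclideanSpace ℝ (Fin n)) (2 * D)) with hW
  have hWtop : W ≠ ∞ := measure_closedBall_lt_top.ne
  obtain ⟨N, hN⟩ := ENNReal.exists_nat_mul_gt (a := ENNReal.ofReal V) (b := 2 * n * W)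
    (by simpa using hV) (by finiteness)
  have hN0 : 0 < N := Nat.pos_of_ne_zero fun h => by simp [h] at hN
  refine ⟨D / N / n, by positivity, fun Ω hΩ hb hc hvol hdiam => ?_⟩
  let F : EuclideanSpace ℝ (Fin n) → Set (EuclideanSpace ℝ (Fin n)) :=
    fun e => {x ∈ Ω | x + (D / N) • e ∉ Ω}
  have hF : ∀ e : EuclideanSpace ℝ (Fin n), ‖e‖ = 1 → N * volume (F e) ≤ W := fun e he =>
    natCast_mul_volume_exit_le hΩ hb hc hD hdiam he hN0
  obtain ⟨x, hx, hxF⟩ : ∃ x ∈ Ω, x ∉ ⋃ i : Fin n,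
      (F (EuclideanSpace.single i 1) ∪ F (-EuclideanSpace.single i 1)) := by
    by_contra! hcon
    have h1 : volume Ω ≤ ∑ i : Fin n, (volume (F (EuclideanSpace.single i 1)) +
        volume (F (-EuclideanSpace.single i 1))) :=
      (measure_mono hcon).trans <| (measure_iUnion_fintype_le _ _).trans <|
        Finset.sum_le_sum fun i _ => measure_union_le _ _
    have h2 : N * volume Ω ≤ 2 * n * W := calc
      N * volume Ω ≤ N * ∑ i : Fin n, (volume (F (EuclideanSpace.single i 1)) +
        volume (F (-EuclideanSpace.single i 1))) := by gcongr
      _ = ∑ i : Fin n, (N * volume (F (EuclideanSpace.single i 1)) +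
        N * volume (F (-EuclideanSpace.single i 1))) := by simp only [Finset.mul_sum, mul_add]
      _ ≤ ∑ i : Fin n, (W + W) := by
        gcongr with i _
        · exact hF _ (by simp)
        · exact hF _ (by simp)
      _ = 2 * n * W := by simp; ring
    rw [hvol] at h2
    exact absurd h2 (not_le.2 hN)
  simp only [Set.mem_iUnion, Set.mem_union, not_exists, not_or] at hxF
  exact ⟨x, hc.ball_subset_of_forall_single_mem hn (by positivity)
    (fun i => by_contra fun h => (hxF i).1 ⟨hx, h⟩) (fun i => by_contra fun h => (hxF i).2 ⟨hx, h⟩)⟩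

/-- The integral over a convex set of a nonnegative directional derivative of a bounded function. -/
lemma lintegral_directional_deriv_le (hΩ : IsOpen Ω) (hb : Bornology.IsBounded Ω)
    (hc : Convex ℝ Ω) (hD : 0 < D) (hdiam : Metric.diam Ω = D) {e : EuclideanSpace ℝ (Fin n)}
    (he : ‖e‖ = 1) {g k : EuclideanSpace ℝ (Fin n) → ℝ} {L : ℝ} (hg : Measurable g)
    (hgL : ∀ x ∈ Ω, |g x| ≤ L) (hk : ∀ x ∈ Ω, HasDerivAt (fun s : ℝ => g (x + s • e)) (k x) 0)
    (hk0 : ∀ x ∈ Ω, 0 ≤ k x) :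
    ∫⁻ x in Ω, ENNReal.ofReal (k x) ≤ ENNReal.ofReal (2 * L / D) *
      volume (closedBall (0 : EuclideanSpace ℝ (Fin n)) (2 * D)) := by
  set W := volume (closedBall (0 : EuclideanSpace ℝ (Fin n)) (2 * D)) with hW
  have hmono : ∀ x ∈ Ω, ∀ h : ℝ, 0 ≤ h → x + h • e ∈ Ω → g x ≤ g (x + h • e) := by
    intro x hx h hh hxh
    have hseg : ∀ s ∈ Set.Icc 0 h, x + s • e ∈ Ω := fun s hs => by
      rcases hh.eq_or_lt with rfl | hh
      · have : s = 0 := le_antisymm hs.2 hs.1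
        simpa [this] using hx
      have := hc.add_smul_sub_mem hx hxh (t := s / h)
        ⟨div_nonneg hs.1 hh.le, (div_le_one hh).2 hs.2⟩
      rwa [add_sub_cancel_left, smul_smul, div_mul_cancel₀ _ hh.ne'] at this
    have hder : ∀ s ∈ Set.Icc 0 h, HasDerivAt (fun s : ℝ => g (x + s • e)) (k (x + s • e)) s :=
      fun s hs => by
        have h1 : HasDerivAt (fun t : ℝ => g (x + s • e + t • e)) (k (x + s • e)) (s - s) := by
          simpa using hk _ (hseg s hs)
        have h2 := HasDerivAt.comp (h := fun t => t - s) s h1 ((hasDerivAt_id s).sub_const s)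
        rw [mul_one] at h2
        refine h2.congr_of_eventuallyEq (Eventually.of_forall fun t => ?_)
        simp only [Function.comp]
        congr 1
        module
    have := monotoneOn_of_deriv_nonneg (convex_Icc 0 h)
      (fun s hs => (hder s hs).continuousAt.continuousWithinAt)
      (fun s hs => (hder s (interior_subset hs)).differentiableAt.differentiableWithinAt)
      (fun s hs => by
        rw [(hder s (interior_subset hs)).deriv]
        exact hk0 _ (hseg s (interior_subset hs)))
    simpa using this (Set.left_mem_Icc.2 hh) (Set.right_mem_Icc.2 hh) hh
  let κ : ℕ → ℝ := fun N => D / (N + 1 : ℕ)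
  have hκ0 : ∀ N, 0 < κ N := fun N => by positivity
  have hκt : Tendsto κ atTop (𝓝[≠] 0) := by
    refine tendsto_nhdsWithin_iff.2 ⟨?_, Eventually.of_forall fun N => (hκ0 N).ne'⟩
    exact (tendsto_const_div_atTop_nhds_zero_nat D).comp (tendsto_add_atTop_nat 1)
  let G : ℕ → Set (EuclideanSpace ℝ (Fin n)) := fun N => {x ∈ Ω | x + κ N • e ∈ Ω}
  have hGm : ∀ N, MeasurableSet (G N) := fun N => hΩ.measurableSet.inter
    (hΩ.preimage (f := fun x => x + κ N • e) (by fun_prop)).measurableSet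
  let q : ℕ → EuclideanSpace ℝ (Fin n) → ℝ≥0∞ := fun N => (G N).indicator fun x =>
    ENNReal.ofReal ((κ N)⁻¹ * (g (x + κ N • e) - g x))
  have hqm : ∀ N, Measurable (q N) := fun N => Measurable.indicator (by fun_prop) (hGm N)
  have hlim : ∀ x ∈ Ω, Tendsto (fun N => q N x) atTop (𝓝 (ENNReal.ofReal (k x))) := by
    intro x hx
    have h1 : ∀ᶠ N in atTop, x ∈ G N := by
      have : Continuous fun s : ℝ => x + s • e := by fun_prop
      have h2 : ∀ᶠ s in 𝓝 (0 : ℝ), x + s • e ∈ Ω :=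
        this.continuousAt.eventually (by simpa using hΩ.mem_nhds hx)
      filter_upwards [(tendsto_nhdsWithin_iff.1 hκt).1.eventually h2] with N hN using ⟨hx, hN⟩
    have h3 := (ENNReal.continuous_ofReal.tendsto _).comp
      ((hasDerivAt_iff_tendsto_slope_zero.1 (hk x hx)).comp hκt)
    refine h3.congr' ?_
    filter_upwards [h1] with N hN
    simp [q, Set.indicator_of_mem hN]
  have hbound : ∀ N, ∫⁻ x in Ω, q N x ≤ ENNReal.ofReal (2 * L / D) * W := by
    intro N
    let α : EuclideanSpace ℝ (Fin n) → ℝ≥0∞ := fun x => ENNReal.ofReal (g x + L)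
    have hαm : Measurable α := by fun_prop
    set F := {x ∈ Ω | x + (D / (N + 1 : ℕ)) • e ∉ Ω} with hF
    have hα : ∀ x ∈ Ω, α x ≤ ENNReal.ofReal (2 * L) := fun x hx =>
      ENNReal.ofReal_le_ofReal (by linarith [(abs_le.1 (hgL x hx)).2])
    have hvolΩ : volume Ω ≠ ∞ := hb.measure_lt_top.ne
    have hfin : ∫⁻ x in G N, α x ≠ ∞ := by
      refine ((setLIntegral_mono measurable_const fun x hx => hα x hx.1).trans_lt ?_).ne
      rw [setLIntegral_const]
      exact ENNReal.mul_lt_top (by finiteness)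
        ((measure_mono fun x hx => hx.1).trans_lt hvolΩ.lt_top)
    have hshift : ∫⁻ x in G N, α (x + κ N • e) ≤ (∫⁻ x in G N, α x) + ENNReal.ofReal (2 * L) *
        volume F := by
      let A : Set (EuclideanSpace ℝ (Fin n)) := {x ∈ Ω | x - κ N • e ∈ Ω}
      have hpre : (fun x => x + κ N • e) ⁻¹' A = G N := by
        ext x; simp [A, G, and_comm]
      calc ∫⁻ x in G N, α (x + κ N • e) = ∫⁻ x in A, α x := by
            rw [← hpre]
            refine (measurePreserving_add_right volume (κ N • e)).setLIntegral_comp_preimage ?_ hαm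
            exact hΩ.measurableSet.inter
              (hΩ.preimage (f := fun x => x - κ N • e) (by fun_prop)).measurableSet
        _ ≤ ∫⁻ x in G N ∪ F, α x := lintegral_mono_set fun x hx => by
            by_cases h : x + κ N • e ∈ Ω
            · exact Or.inl ⟨hx.1, h⟩
            · exact Or.inr ⟨hx.1, h⟩
        _ ≤ (∫⁻ x in G N, α x) + ∫⁻ x in F, α x := lintegral_union_le _ _ _
        _ ≤ _ := by
            gcongr
            rw [← setLIntegral_const]
            exact setLIntegral_mono measurable_const fun x hx => hα x hx.1
    have hexit : ((N + 1 : ℕ) : ℝ≥0∞) * volume F ≤ W :=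
      natCast_mul_volume_exit_le hΩ hb hc hD hdiam he N.succ_pos
    calc ∫⁻ x in Ω, q N x = ∫⁻ x in G N, ENNReal.ofReal ((κ N)⁻¹ * (g (x + κ N • e) - g x)) := by
          rw [lintegral_indicator (hGm N), Measure.restrict_restrict (hGm N),
            Set.inter_eq_left.2 fun x hx => hx.1]
      _ = ∫⁻ x in G N, ENNReal.ofReal (κ N)⁻¹ * (α (x + κ N • e) - α x) := by
          refine setLIntegral_congr_fun (hGm N) fun x hx => ?_
          have := (abs_le.1 (hgL x hx.1)).1
          simp only [α]
          rw [← ENNReal.ofReal_sub _ (by linarith), ← ENNReal.ofReal_mul (inv_pos.2 (hκ0 N)).le]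
          congr 2
          ring
      _ = ENNReal.ofReal (κ N)⁻¹ * ((∫⁻ x in G N, α (x + κ N • e)) - ∫⁻ x in G N, α x) := by
          rw [lintegral_const_mul _ (by fun_prop), lintegral_sub hαm hfin]
          refine (ae_restrict_iff' (hGm N)).2 (Eventually.of_forall fun x hx => ?_)
          exact ENNReal.ofReal_le_ofReal (by linarith [hmono x hx.1 _ (hκ0 N).le hx.2])
      _ ≤ ENNReal.ofReal (κ N)⁻¹ * (ENNReal.ofReal (2 * L) * volume F) := by
          gcongr
          exact tsub_le_iff_left.2 hshift
      _ = ENNReal.ofReal (2 * L / D) * ((N + 1 : ℕ) * volume F) := by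
          have h1 : (κ N)⁻¹ = (1 / D) * (N + 1 : ℕ) := by simp [κ]; field_simp
          have h2 : (2 * L / D) = (1 / D) * (2 * L) := by ring
          rw [h1, h2, ENNReal.ofReal_mul (q := (N + 1 : ℕ)) (by positivity),
            ENNReal.ofReal_mul (p := 1 / D) (q := 2 * L) (by positivity),
            ENNReal.ofReal_natCast]
          ring
      _ ≤ _ := by gcongr
  calc ∫⁻ x in Ω, ENNReal.ofReal (k x) = ∫⁻ x in Ω, liminf (fun N => q N x) atTop :=
        setLIntegral_congr_fun hΩ.measurableSet fun x hx => (hlim x hx).liminf_eq.symm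
    _ ≤ liminf (fun N => ∫⁻ x in Ω, q N x) atTop := lintegral_liminf_le hqm
    _ ≤ _ := liminf_le_of_le (by isBoundedDefault) fun b hb => by
        obtain ⟨N, hN⟩ := hb.exists
        exact hN.trans (hbound N)

end ConvexGeometry

section MongeAmpere

variable {n : ℕ} {Ω : Set (EuclideanSpace ℝ (Fin n))} {u : EuclideanSpace ℝ (Fin n) → ℝ}
  {p M D S : ℝ}

lemma EuclideanSpace.ofLp_dotProduct_self (d : EuclideanSpace ℝ (Fin n)) :
    d.ofLp ⬝ᵥ d.ofLp = ‖d‖ ^ 2 := by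
  rw [EuclideanSpace.real_norm_sq_eq]
  simp [dotProduct, sq]

lemma EuclideanSpace.ofLp_dotProduct (d e : EuclideanSpace ℝ (Fin n)) :
    d.ofLp ⬝ᵥ e.ofLp = inner ℝ e d := by
  rw [EuclideanSpace.inner_eq_star_dotProduct, star_trivial]

lemma nonpos_of_hessianDet_eq (hn : n ≠ 0) (hM : 0 < M) (hΩ : IsOpen Ω)
    (hb : Bornology.IsBounded Ω) (hcont : ContinuousOn u (closure Ω))
    (hsmooth : ∀ x ∈ Ω, ContDiffAt ℝ 2 u x) (hconv : ConvexOn ℝ Ω u)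
    (heq : ∀ x ∈ Ω, hessianDet u x = M * |u x| ^ p) (hbd : ∀ x ∈ frontier Ω, u x = 0) :
    ∀ x ∈ Ω, u x ≤ 0 := by
  intro x hx
  obtain ⟨x₁, hx₁, hmax⟩ := hb.isCompact_closure.exists_isMaxOn ⟨x, subset_closure hx⟩ hcont
  refine (hmax (subset_closure hx)).trans ?_
  by_contra! hpos
  have hx₁Ω : x₁ ∈ Ω := by
    by_contra h
    exact hpos.ne' (hbd x₁ (by rw [hΩ.frontier_eq]; exact ⟨hx₁, h⟩))
  have hloc : IsLocalMax u x₁ := hmax.isLocalMax (mem_of_superset (hΩ.mem_nhds hx₁Ω) subset_closure)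
  have hle : ∀ v, v ⬝ᵥ hessianMatrix u x₁ *ᵥ v ≤ 0 * (v ⬝ᵥ v) := fun v => by
    rw [zero_mul]
    refine hessianMatrix_le_of_isLocalMax (hsmooth x₁ hx₁Ω) (WithLp.toLp 2 v) (g := fun _ => 0)
      (g' := fun _ => 0) (Eventually.of_forall fun s => hasDerivAt_const s 0)
      (hasDerivAt_const 0 0) ?_
    have hc : Continuous fun s : ℝ => x₁ + s • WithLp.toLp 2 v := by fun_prop
    have := hc.continuousAt (x := 0)
    rw [ContinuousAt, zero_smul, add_zero] at this
    filter_upwards [this.eventually hloc] with s hs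
    simpa using hs
  have hdet := Matrix.det_le_pow_of_posSemidef
    (posSemidef_hessianMatrix hΩ (hsmooth x₁ hx₁Ω) hx₁Ω hconv) le_rfl hle
  have h2 := heq x₁ hx₁Ω
  rw [Fintype.card_fin, zero_pow hn] at hdet
  have : 0 < M * |u x₁| ^ p := mul_pos hM (Real.rpow_pos_of_pos (abs_pos.2 hpos.ne') _)
  rw [hessianDet] at h2
  linarith

/-- Comparison with a paraboloid on a ball where `u` is at most half of its minimum. -/
lemma mul_rpow_le_of_ball_subset (hM : 0 < M) (hp : 0 < p) (hS : 0 < S) (hΩ : IsOpen Ω)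
    (hsmooth : ∀ x ∈ Ω, ContDiffAt ℝ 2 u x) (hconv : ConvexOn ℝ Ω u)
    (heq : ∀ x ∈ Ω, hessianDet u x = M * |u x| ^ p) (hneg : ∀ x ∈ Ω, u x ≤ 0)
    (hSle : ∀ x ∈ Ω, -S ≤ u x) {x₀ : EuclideanSpace ℝ (Fin n)} (hx₀ : x₀ ∈ Ω) (hux₀ : u x₀ = -S)
    {y : EuclideanSpace ℝ (Fin n)} {r : ℝ} (hr : 0 < r) (hball : ball y r ⊆ Ω) :
    M * (S / 2) ^ p ≤ (64 * S / r ^ 2) ^ n := by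
  set c := (1 / 2 : ℝ) • x₀ + (1 / 2 : ℝ) • y with hc
  set ρ := r / 4 with hρ
  have hρ0 : 0 < ρ := by positivity
  set k := 2 * S / ρ ^ 2 with hk
  have hk0 : 0 < k := by positivity
  have hsub : ∀ x ∈ closedBall c ρ, x ∈ Ω ∧ u x ≤ -S / 2 := fun x hx => by
    have hy' : (2 : ℝ) • x - x₀ ∈ Ω := hball <| by
      have h1 : (2 : ℝ) • x - x₀ - y = (2 : ℝ) • (x - c) := by rw [hc]; module
      rw [mem_ball, dist_eq_norm, h1, norm_smul, Real.norm_of_nonneg zero_le_two]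
      rw [mem_closedBall, dist_eq_norm] at hx
      linarith
    have hx' : x = (1 / 2 : ℝ) • x₀ + (1 / 2 : ℝ) • ((2 : ℝ) • x - x₀) := by module
    have h12 : (0 : ℝ) ≤ 1 / 2 := by norm_num
    refine ⟨?_, ?_⟩
    · rw [hx']
      exact hconv.1 hx₀ hy' h12 h12 (by norm_num)
    · have := hconv.2 hx₀ hy' h12 h12 (by norm_num)
      rw [← hx', hux₀, smul_eq_mul, smul_eq_mul] at this
      linarith [hneg _ hy']
  have hwc : ContinuousOn (fun x => u x - k * ‖x - c‖ ^ 2) (closedBall c ρ) := by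
    refine ContinuousOn.sub (fun x hx => ?_) (by fun_prop)
    exact (hsmooth x (hsub x hx).1).continuousAt.continuousWithinAt
  have hcmem : c ∈ closedBall c ρ := mem_closedBall_self hρ0.le
  obtain ⟨x₁, hx₁, hmax⟩ := (isCompact_closedBall c ρ).exists_isMaxOn ⟨c, hcmem⟩ hwc
  have hx₁Ω := (hsub x₁ hx₁).1
  have hx₁b : x₁ ∈ ball c ρ := by
    rw [mem_ball, dist_eq_norm]
    rw [mem_closedBall, dist_eq_norm] at hx₁
    refine lt_of_le_of_ne hx₁ fun h => ?_
    have h1 := hmax hcmem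
    simp only [Set.mem_ofPred_eq, sub_self, norm_zero] at h1
    rw [h, hk, div_mul_cancel₀ _ (by positivity)] at h1
    linarith [hSle c (hsub c hcmem).1, hneg x₁ hx₁Ω]
  have hle : ∀ v, v ⬝ᵥ hessianMatrix u x₁ *ᵥ v ≤ 2 * k * (v ⬝ᵥ v) := fun v => by
    set d : EuclideanSpace ℝ (Fin n) := WithLp.toLp 2 v with hd
    have hvv : v ⬝ᵥ v = ‖d‖ ^ 2 := EuclideanSpace.ofLp_dotProduct_self d
    rw [hvv]
    have hcd : Continuous fun s : ℝ => x₁ + s • d := by fun_prop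
    refine hessianMatrix_le_of_isLocalMax (hsmooth x₁ hx₁Ω) d
      (g := fun s => k * (‖x₁ - c‖ ^ 2 + 2 * s * inner ℝ (x₁ - c) d + s ^ 2 * ‖d‖ ^ 2))
      (g' := fun s => k * (2 * inner ℝ (x₁ - c) d + 2 * s * ‖d‖ ^ 2))
      (Eventually.of_forall fun s => ?_) ?_ ?_
    · have h1 := (((hasDerivAt_id s).const_mul 2).mul_const (inner ℝ (x₁ - c) d)).const_add
        (‖x₁ - c‖ ^ 2)
      have h2 := (h1.add (((hasDerivAt_id s).pow 2).mul_const (‖d‖ ^ 2))).const_mul k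
      refine h2.congr_deriv ?_
      simp
    · have h1 := ((((hasDerivAt_id (0 : ℝ)).const_mul 2).mul_const (‖d‖ ^ 2)).const_add
        (2 * inner ℝ (x₁ - c) d)).const_mul k
      refine h1.congr_deriv ?_
      ring
    · have hloc : IsLocalMax (fun x => u x - k * ‖x - c‖ ^ 2) x₁ :=
        hmax.isLocalMax (mem_of_superset (isOpen_ball.mem_nhds hx₁b) ball_subset_closedBall)
      have := hcd.continuousAt (x := 0)
      rw [ContinuousAt, zero_smul, add_zero] at this
      have hexp : ∀ s : ℝ, ‖x₁ + s • d - c‖ ^ 2 =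
          ‖x₁ - c‖ ^ 2 + 2 * s * inner ℝ (x₁ - c) d + s ^ 2 * ‖d‖ ^ 2 := fun s => by
        have : x₁ + s • d - c = x₁ - c + s • d := by module
        rw [this, norm_add_sq_real, inner_smul_right, norm_smul, mul_pow, Real.norm_eq_abs, sq_abs]
        ring
      filter_upwards [this.eventually hloc] with s hs
      rw [hexp] at hs
      simpa using hs
  have hdet := Matrix.det_le_pow_of_posSemidef
    (posSemidef_hessianMatrix hΩ (hsmooth x₁ hx₁Ω) hx₁Ω hconv) (by positivity) hle
  have h2 := heq x₁ hx₁Ω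
  rw [hessianDet] at h2
  rw [h2, Fintype.card_fin] at hdet
  have h3 : 2 * k = 64 * S / r ^ 2 := by rw [hk, hρ]; field_simp; ring
  rw [← h3]
  refine le_trans ?_ hdet
  gcongr
  rw [abs_of_nonpos (hneg _ hx₁Ω)]
  linarith [(hsub x₁ hx₁).2]

end MongeAmpere

section BoundaryBarrier

variable {n : ℕ} {Ω : Set (EuclideanSpace ℝ (Fin n))} {u : EuclideanSpace ℝ (Fin n) → ℝ}
  {p M D S : ℝ}

lemma hasDerivAt_barrier {t a K δ c b m θ s : ℝ} (hs : 0 < t + s * a) :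
    HasDerivAt
      (fun s => θ * (-K * (t + s * a) + (t + s * a) ^ (1 + δ) * (c + 2 * s * b + s ^ 2 * m)))
      (θ * (-K * a + ((1 + δ) * (t + s * a) ^ δ * a * (c + 2 * s * b + s ^ 2 * m) +
        (t + s * a) ^ (1 + δ) * (2 * b + 2 * s * m)))) s := by
  have h1 : HasDerivAt (fun s => t + s * a) a s := by
    simpa using ((hasDerivAt_id s).mul_const a).const_add t
  have h2 := h1.rpow_const (p := 1 + δ) (Or.inl hs.ne')
  have h3 : HasDerivAt (fun s => c + 2 * s * b + s ^ 2 * m) (2 * b + 2 * s * m) s := by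
    have := ((((hasDerivAt_id s).const_mul 2).mul_const b).const_add c).add
      (((hasDerivAt_id s).pow 2).mul_const m)
    refine this.congr_deriv ?_
    simp
  refine (((h1.const_mul (-K)).add (h2.mul h3)).const_mul θ).congr_deriv ?_
  rw [show 1 + δ - 1 = δ by ring]
  ring

lemma hasDerivAt_deriv_barrier {t a K δ c b m θ : ℝ} (ht : 0 < t) :
    HasDerivAt
      (fun s => θ * (-K * a + ((1 + δ) * (t + s * a) ^ δ * a * (c + 2 * s * b + s ^ 2 * m) +
        (t + s * a) ^ (1 + δ) * (2 * b + 2 * s * m))))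
      (θ * t ^ (δ - 1) * ((1 + δ) * δ * a ^ 2 * c + 4 * (1 + δ) * t * a * b + 2 * t ^ 2 * m))
      0 := by
  have h1 : HasDerivAt (fun s => t + s * a) a 0 := by
    simpa using ((hasDerivAt_id (0 : ℝ)).mul_const a).const_add t
  have h0 : t + 0 * a ≠ 0 := by simpa using ht.ne'
  have h2 := h1.rpow_const (p := 1 + δ) (Or.inl h0)
  have h2' := h1.rpow_const (p := δ) (Or.inl h0)
  have h3 : HasDerivAt (fun s => c + 2 * s * b + s ^ 2 * m) (2 * b) 0 := by
    have := ((((hasDerivAt_id (0 : ℝ)).const_mul 2).mul_const b).const_add c).add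
      (((hasDerivAt_id (0 : ℝ)).pow 2).mul_const m)
    refine this.congr_deriv ?_
    simp
  have h4 : HasDerivAt (fun s => 2 * b + 2 * s * m) (2 * m) 0 := by
    simpa using ((((hasDerivAt_id (0 : ℝ)).const_mul 2).mul_const m).const_add (2 * b))
  have h5 := (((((h2'.const_mul (1 + δ)).mul_const a).mul h3).add (h2.mul h4)).const_add
    (-K * a)).const_mul θ
  refine h5.congr_deriv ?_
  have e1 : t ^ δ = t ^ (δ - 1) * t := by
    rw [← Real.rpow_add_one ht.ne']; congr 1; ring
  have e2 : t ^ (1 + δ) = t ^ (δ - 1) * t ^ 2 := by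
    rw [← Real.rpow_natCast, ← Real.rpow_add ht]; congr 1; push_cast; ring
  simp only [zero_mul, add_zero, mul_zero, ne_eq, OfNat.ofNat_ne_zero, not_false_eq_true, zero_pow,
    show 1 + δ - 1 = δ by ring]
  rw [e2, e1]
  ring

lemma barrier_quadratic_form_ge {t a b m δ R D Y : ℝ} (ht : 0 ≤ t) (hδ : 0 < δ)
    (hR : 4 * (1 + δ) ^ 2 * D ^ 2 + 1 ≤ (1 + δ) * δ * R) (hY : Y ≤ D) (hm : 0 ≤ m)
    (hb : |b| ≤ Y * m) :
    t ^ 2 * m ^ 2 + a ^ 2 ≤ (1 + δ) * δ * a ^ 2 * (R + Y ^ 2) + 4 * (1 + δ) * t * a * b +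
      2 * t ^ 2 * m ^ 2 := by
  have hab : -(|a| * (D * m)) ≤ a * b := by
    have h1 := neg_abs_le (a * b)
    have h2 : |a * b| ≤ |a| * (D * m) := by
      rw [abs_mul]
      gcongr
      exact hb.trans (by gcongr)
    linarith
  have h0 := mul_le_mul_of_nonneg_left hab (show 0 ≤ 4 * (1 + δ) * t by positivity)
  have h1 : 0 ≤ (1 + δ) * δ * a ^ 2 * Y ^ 2 := by positivity
  have h2 : (4 * (1 + δ) ^ 2 * D ^ 2 + 1) * a ^ 2 ≤ (1 + δ) * δ * R * a ^ 2 := by gcongr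
  have h3 := sq_nonneg (t * m - 2 * (1 + δ) * |a| * D)
  have h4 := sq_abs a
  have h5 : (t * m - 2 * (1 + δ) * |a| * D) ^ 2 = t ^ 2 * m ^ 2 - 4 * (1 + δ) * t * (|a| * (D * m))
      + 4 * (1 + δ) ^ 2 * a ^ 2 * D ^ 2 := by rw [← h4]; ring
  linarith

/-- Boundary barrier: `-u` grows at most linearly away from a supporting hyperplane. -/
lemma neg_le_of_supporting_hyperplane (hn : 0 < n) (hM : 0 < M) (hS : 0 < S) (hD : 0 < D)
    (hΩ : IsOpen Ω) (hb : Bornology.IsBounded Ω) (hdiam : Metric.diam Ω = D)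
    (hcont : ContinuousOn u (closure Ω)) (hsmooth : ∀ x ∈ Ω, ContDiffAt ℝ 2 u x)
    (heq : ∀ x ∈ Ω, hessianDet u x = M * |u x| ^ p) (hbd : ∀ x ∈ frontier Ω, u x = 0)
    (hneg : ∀ x ∈ Ω, u x ≤ 0) (hSle : ∀ x ∈ Ω, -S ≤ u x)
    {q δ R K C₀ : ℝ} (hq : 0 < q) (hqp : q ≤ p) (hqn : q < n) (hδ : 0 < δ)
    (hqδ : n * δ = q - (n - 2)) (hR0 : 0 < R)
    (hR : 4 * (1 + δ) ^ 2 * D ^ 2 + 1 ≤ (1 + δ) * δ * R)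
    (hK : (D + 1) ^ δ * (R + D ^ 2) + 1 ≤ K) (hC₀ : 0 < C₀) (hMS : M * S ^ p ≤ C₀ * S ^ (n : ℝ))
    {z ν : EuclideanSpace ℝ (Fin n)} (hz : z ∈ closure Ω) (hν : ‖ν‖ = 1)
    (hsupp : ∀ x ∈ Ω, 0 ≤ inner ℝ (x - z) ν) {ε : ℝ} (hε : 0 < ε) (hε1 : ε ≤ 1) :
    ∀ x ∈ Ω, -u x ≤ (C₀ * K ^ q) ^ (1 / (n - q)) * S * K * (‖x - z‖ + ε) := by
  set t : EuclideanSpace ℝ (Fin n) → ℝ := fun x => inner ℝ (x - z) ν + ε with ht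
  have htc : Continuous t := by fun_prop
  have hεt : ∀ x ∈ closure Ω, ε ≤ t x := fun x hx => by
    refine closure_minimal (s := Ω) (t := {x | ε ≤ t x}) (fun y hy => ?_)
      (isClosed_le continuous_const htc) hx
    have := hsupp y hy
    change ε ≤ inner ℝ (y - z) ν + ε
    linarith
  have ht0 : ∀ x ∈ closure Ω, 0 < t x := fun x hx => hε.trans_le (hεt x hx)
  have hxz : ∀ x ∈ closure Ω, ‖x - z‖ ≤ D := fun x hx => by
    rw [← dist_eq_norm, ← hdiam, ← Metric.diam_closure]
    exact Metric.dist_le_diam_of_mem hb.closure hx hz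
  have htle : ∀ x, t x ≤ ‖x - z‖ + ε := fun x => by
    have := real_inner_le_norm (x - z) ν
    rw [hν, mul_one] at this
    simp only [ht]; linarith
  have hK0 : 0 < K := by have : 0 < (D + 1) ^ δ * (R + D ^ 2) := by positivity
                         linarith
  let ψ : EuclideanSpace ℝ (Fin n) → ℝ := fun x => K * t x - t x ^ (1 + δ) * (R + ‖x - z‖ ^ 2)
  have hψ1 : ∀ x ∈ closure Ω, t x ≤ ψ x := fun x hx => by
    have h0 := ht0 x hx
    have h1 : t x ^ (1 + δ) = t x * t x ^ δ := by rw [Real.rpow_add h0, Real.rpow_one]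
    have h2 : t x ^ δ * (R + ‖x - z‖ ^ 2) ≤ (D + 1) ^ δ * (R + D ^ 2) := by
      gcongr
      · linarith [htle x, hxz x hx]
      · exact hxz x hx
    simp only [ψ, h1]
    nlinarith
  have hψ0 : ∀ x ∈ closure Ω, 0 < ψ x := fun x hx => (ht0 x hx).trans_le (hψ1 x hx)
  have hψ2 : ∀ x ∈ closure Ω, ψ x ≤ K * t x := fun x hx => by
    have h0 := ht0 x hx
    have : 0 ≤ t x ^ (1 + δ) * (R + ‖x - z‖ ^ 2) := by positivity
    simp only [ψ]; linarith
  have hψc : ContinuousOn ψ (closure Ω) := by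
    refine ContinuousOn.sub (by fun_prop) (ContinuousOn.mul ?_ (by fun_prop))
    exact htc.continuousOn.rpow_const fun x hx => Or.inl (ht0 x hx).ne'
  intro x hx
  rcases (hneg x hx).eq_or_lt with hux | hux
  · rw [hux, neg_zero]; positivity
  obtain ⟨x₁, hx₁, hmax⟩ := hb.isCompact_closure.exists_isMaxOn ⟨x, subset_closure hx⟩
    (hcont.neg.div hψc fun y hy => (hψ0 y hy).ne')
  set θ := -u x₁ / ψ x₁ with hθ
  have hle : ∀ y ∈ closure Ω, -u y ≤ θ * ψ y := fun y hy => (div_le_iff₀ (hψ0 y hy)).1 (hmax hy)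
  have hux₁ : -u x₁ = θ * ψ x₁ := by rw [hθ, div_mul_cancel₀ _ (hψ0 x₁ hx₁).ne']
  have hθ0 : 0 < θ := by
    have h1 := hle x (subset_closure hx)
    by_contra! h
    nlinarith [hψ0 x (subset_closure hx)]
  have hx₁Ω : x₁ ∈ Ω := by
    by_contra h
    have := hbd x₁ (by rw [hΩ.frontier_eq]; exact ⟨hx₁, h⟩)
    rw [this, neg_zero] at hux₁
    exact (mul_pos hθ0 (hψ0 x₁ hx₁)).ne hux₁
  set τ := t x₁ with hτ
  have hτ0 : 0 < τ := ht0 x₁ hx₁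
  have hform : ∀ v, θ * τ ^ (1 + δ) * (v ⬝ᵥ v) + θ * τ ^ (δ - 1) * (ν.ofLp ⬝ᵥ v) ^ 2 ≤
      v ⬝ᵥ hessianMatrix u x₁ *ᵥ v := fun v => by
    set d : EuclideanSpace ℝ (Fin n) := WithLp.toLp 2 v with hd
    have hvv : v ⬝ᵥ v = ‖d‖ ^ 2 := EuclideanSpace.ofLp_dotProduct_self d
    have hνv : ν.ofLp ⬝ᵥ v = inner ℝ d ν := EuclideanSpace.ofLp_dotProduct ν d
    have hcd : Continuous fun s : ℝ => x₁ + s • d := by fun_prop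
    have hline : ∀ s : ℝ, t (x₁ + s • d) = τ + s * inner ℝ d ν := fun s => by
      have : x₁ + s • d - z = x₁ - z + s • d := by module
      simp only [hτ, ht, this, inner_add_left, real_inner_smul_left]
      ring
    have hexp : ∀ s : ℝ, R + ‖x₁ + s • d - z‖ ^ 2 =
        (R + ‖x₁ - z‖ ^ 2) + 2 * s * inner ℝ (x₁ - z) d + s ^ 2 * ‖d‖ ^ 2 := fun s => by
      have : x₁ + s • d - z = x₁ - z + s • d := by module
      rw [this, norm_add_sq_real, inner_smul_right, norm_smul, mul_pow, Real.norm_eq_abs, sq_abs]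
      ring
    have hxd := hcd.continuousAt (x := 0)
    rw [ContinuousAt, zero_smul, add_zero] at hxd
    have hmem : ∀ᶠ s in 𝓝 (0 : ℝ), x₁ + s • d ∈ Ω := hxd.eventually (hΩ.mem_nhds hx₁Ω)
    have hgψ : ∀ s : ℝ, θ * (-K * (τ + s * inner ℝ d ν) + (τ + s * inner ℝ d ν) ^ (1 + δ) *
        ((R + ‖x₁ - z‖ ^ 2) + 2 * s * inner ℝ (x₁ - z) d + s ^ 2 * ‖d‖ ^ 2)) =
        -(θ * ψ (x₁ + s • d)) := fun s => by
      simp only [ψ, hline, hexp]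
      ring
    have key := le_hessianMatrix_of_isLocalMin (hsmooth x₁ hx₁Ω) d (hmem.mono fun s hs =>
      hasDerivAt_barrier (K := K) (δ := δ) (c := R + ‖x₁ - z‖ ^ 2) (b := inner ℝ (x₁ - z) d)
        (m := ‖d‖ ^ 2) (θ := θ) (by rw [← hline]; exact ht0 _ (subset_closure hs)))
      (hasDerivAt_deriv_barrier hτ0) (by
        filter_upwards [hmem] with s hs
        rw [hgψ, hgψ, zero_smul, add_zero]
        linarith [hle _ (subset_closure hs)])
    refine le_trans ?_ key
    have hquad := barrier_quadratic_form_ge (t := τ) (a := inner ℝ d ν) (b := inner ℝ (x₁ - z) d)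
      hτ0.le hδ hR (hxz x₁ hx₁) (norm_nonneg d) (abs_real_inner_le_norm _ _)
    have e2 : τ ^ (1 + δ) = τ ^ (δ - 1) * τ ^ 2 := by
      rw [← Real.rpow_natCast, ← Real.rpow_add hτ0]; congr 1; push_cast; ring
    rw [hvv, hνv, e2]
    calc _ = θ * τ ^ (δ - 1) * (τ ^ 2 * ‖d‖ ^ 2 + inner ℝ d ν ^ 2) := by ring
      _ ≤ _ := by gcongr
  have hdet := Matrix.pow_mul_le_det (isHermitian_hessianMatrix (hsmooth x₁ hx₁Ω))
    (by positivity) (by positivity) (by rw [EuclideanSpace.ofLp_dotProduct_self, hν]; norm_num)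
    hform
  have hlow : (θ * τ ^ (1 + δ)) ^ (Fintype.card (Fin n) - 1) * (θ * τ ^ (δ - 1)) =
      θ ^ (n : ℝ) * τ ^ q := by
    rw [Fintype.card_fin]
    obtain ⟨k, rfl⟩ := Nat.exists_eq_succ_of_ne_zero hn.ne'
    rw [Nat.succ_sub_one, mul_pow, ← Real.rpow_natCast (τ ^ (1 + δ)), ← Real.rpow_mul hτ0.le,
      Real.rpow_natCast, Nat.succ_eq_add_one, pow_succ]
    have : q = (1 + δ) * k + (δ - 1) := by push_cast at hqδ; linarith
    rw [this, Real.rpow_add hτ0]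
    ring
  have h2 := heq x₁ hx₁Ω
  rw [hessianDet] at h2
  rw [hlow, h2] at hdet
  have habs : |u x₁| = θ * ψ x₁ := by rw [abs_of_nonpos (hneg _ hx₁Ω), hux₁]
  have hup : M * |u x₁| ^ p ≤ C₀ * S ^ (n - q) * (θ ^ q * K ^ q * τ ^ q) := by
    have h3 : 0 < |u x₁| := by rw [habs]; exact mul_pos hθ0 (hψ0 x₁ hx₁)
    have h4 : |u x₁| ^ p = |u x₁| ^ (p - q) * |u x₁| ^ q := by rw [← Real.rpow_add h3]; congr 1; ring
    have h5 : |u x₁| ^ (p - q) ≤ S ^ (p - q) := by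
      refine Real.rpow_le_rpow h3.le ?_ (by linarith)
      rw [abs_of_nonpos (hneg _ hx₁Ω)]; linarith [hSle x₁ hx₁Ω]
    have h6 : |u x₁| ^ q ≤ θ ^ q * K ^ q * τ ^ q := by
      rw [← Real.mul_rpow hθ0.le hK0.le, ← Real.mul_rpow (by positivity) hτ0.le]
      refine Real.rpow_le_rpow h3.le ?_ hq.le
      rw [habs, mul_assoc]
      gcongr
      exact hψ2 x₁ hx₁
    have h7 : M * S ^ (p - q) ≤ C₀ * S ^ (n - q) := by
      rw [Real.rpow_sub hS, Real.rpow_sub hS, ← mul_div_assoc, ← mul_div_assoc]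
      gcongr
    calc M * |u x₁| ^ p = M * (|u x₁| ^ (p - q) * |u x₁| ^ q) := by rw [h4]
      _ ≤ M * (S ^ (p - q) * (θ ^ q * K ^ q * τ ^ q)) := by gcongr
      _ = (M * S ^ (p - q)) * (θ ^ q * K ^ q * τ ^ q) := by ring
      _ ≤ _ := by gcongr
  have hnq : (0 : ℝ) < n - q := by linarith
  have hθle : θ ≤ (C₀ * K ^ q) ^ (1 / (n - q)) * S := by
    have h3 : θ ^ (n - q) ≤ C₀ * K ^ q * S ^ (n - q) := by
      have h4 : 0 < θ ^ q * τ ^ q := by positivity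
      refine le_of_mul_le_mul_right ?_ h4
      calc θ ^ (n - q) * (θ ^ q * τ ^ q) = θ ^ (n : ℝ) * τ ^ q := by
            rw [Real.rpow_sub hθ0]; field_simp
        _ ≤ _ := hdet.trans hup
        _ = _ := by ring
    rw [← Real.rpow_le_rpow_iff hθ0.le (by positivity) hnq, Real.mul_rpow (by positivity) hS.le,
      ← Real.rpow_mul (by positivity), one_div, inv_mul_cancel₀ hnq.ne', Real.rpow_one]
    exact h3
  calc -u x ≤ θ * ψ x := hle x (subset_closure hx)
    _ ≤ ((C₀ * K ^ q) ^ (1 / (n - q)) * S) * (K * (‖x - z‖ + ε)) := by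
        have h8 : ψ x ≤ K * (‖x - z‖ + ε) :=
          (hψ2 x (subset_closure hx)).trans (by gcongr; exact htle x)
        have := (hψ0 x (subset_closure hx)).le
        gcongr
    _ = _ := by ring

/-- A linear bound for `-u` near the boundary bounds the gradient of the convex function `u`. -/
lemma abs_fderiv_le_of_boundary_bound (hΩ : IsOpen Ω) (hb : Bornology.IsBounded Ω)
    (hdiam : Metric.diam Ω = D) (hsmooth : ∀ x ∈ Ω, ContDiffAt ℝ 2 u x) (hconv : ConvexOn ℝ Ω u)
    (hneg : ∀ x ∈ Ω, u x ≤ 0) {L : ℝ} (hL : ∀ x ∈ Ω, ∀ z ∈ frontier Ω, -u x ≤ L * ‖x - z‖)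
    {x e : EuclideanSpace ℝ (Fin n)} (hx : x ∈ Ω) (he : ‖e‖ = 1) :
    |fderiv ℝ u x e| ≤ 2 * L := by
  have key : ∀ e : EuclideanSpace ℝ (Fin n), ‖e‖ = 1 → fderiv ℝ u x e ≤ 2 * L := fun e he => by
    have hc : Continuous fun s : ℝ => x + |s| • e := by fun_prop
    obtain ⟨s, hs⟩ : (frontier ((fun s : ℝ => x + |s| • e) ⁻¹' Ω)).Nonempty := by
      refine nonempty_frontier_iff.2 ⟨⟨0, by simpa using hx⟩, fun h => ?_⟩
      have h1 : D + 1 ∈ (fun s : ℝ => x + |s| • e) ⁻¹' Ω := h ▸ Set.mem_univ _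
      have h2 := Metric.dist_le_diam_of_mem hb h1 hx
      rw [hdiam, dist_self_add_left, norm_smul, he, mul_one, Real.norm_eq_abs, abs_abs] at h2
      linarith [le_abs_self (D + 1)]
    have hz := hc.frontier_preimage_subset Ω hs
    set r := |s| with hr
    change x + r • e ∈ frontier Ω at hz
    have hr0 : 0 < r := by
      refine (abs_nonneg s).lt_of_ne fun h => ?_
      rw [hr, ← h, zero_smul, add_zero, hΩ.frontier_eq] at hz
      exact hz.2 hx
    have hmid : x + (r / 2) • e ∈ Ω := by
      have := hconv.1.combo_interior_closure_mem_interior (hΩ.interior_eq.symm ▸ hx)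
        (frontier_subset_closure hz) (show (0 : ℝ) < 1 / 2 by norm_num)
        (show (0 : ℝ) ≤ 1 / 2 by norm_num) (by norm_num)
      rw [hΩ.interior_eq] at this
      convert this using 1
      module
    have hl : (fun s : ℝ => x + s • e) =
        (AffineMap.lineMap x (x + e) : ℝ →ᵃ[ℝ] EuclideanSpace ℝ (Fin n)) := by
      ext1 s
      simp [AffineMap.lineMap_apply, add_comm]
    have hline : ConvexOn ℝ ((fun s : ℝ => x + s • e) ⁻¹' Ω) (u ∘ fun s : ℝ => x + s • e) := by
      rw [hl]
      exact hconv.comp_affineMap _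
    have hder := (hasDerivAt_comp_line (hsmooth x hx) e).self_of_nhds
    have h1 := hline.le_slope_of_hasDerivAt (by simpa using hx) hmid (half_pos hr0) hder
    simp only [slope_def_field, Function.comp_apply, zero_smul, add_zero, sub_zero] at h1
    have h2 := hL x hx _ hz
    rw [sub_add_cancel_left, norm_neg, norm_smul, he, mul_one, Real.norm_of_nonneg hr0.le] at h2
    refine h1.trans ((div_le_iff₀ (half_pos hr0)).2 ?_)
    linarith [hneg _ hmid]
  rw [abs_le]
  have h1 := key (-e) (by rwa [norm_neg])
  rw [map_neg] at h1
  exact ⟨by linarith, key e he⟩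

end BoundaryBarrier

section HessianIntegral

variable {n : ℕ}

lemma exists_supporting_normal {E : Type*} [NormedAddCommGroup E] [InnerProductSpace ℝ E]
    [CompleteSpace E] {Ω : Set E} (hΩ : IsOpen Ω) (hc : Convex ℝ Ω) (hne : Ω.Nonempty) {z : E}
    (hz : z ∉ Ω) : ∃ ν : E, ‖ν‖ = 1 ∧ ∀ x ∈ Ω, 0 ≤ inner ℝ (x - z) ν := by
  obtain ⟨f, hf⟩ := geometric_hahn_banach_point_open hc hΩ hz
  set w := (InnerProductSpace.toDual ℝ E).symm f with hw
  have hwf : ∀ x, inner ℝ x w = f x := fun x => by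
    rw [real_inner_comm, hw, InnerProductSpace.toDual_symm_apply]
  have hw0 : w ≠ 0 := by
    obtain ⟨x, hx⟩ := hne
    rintro h
    have h1 := hwf x
    have h2 := hwf z
    rw [h, inner_zero_right] at h1 h2
    linarith [hf x hx]
  refine ⟨‖w‖⁻¹ • w, by simp [norm_smul, hw0], fun x hx => ?_⟩
  rw [inner_smul_right, inner_sub_left, hwf, hwf]
  exact mul_nonneg (by positivity) (by linarith [hf x hx])

/-- The linear boundary bound `-u ≤ C ‖u‖_∞ dist(·, ∂Ω)` with a uniform constant `C`. -/
lemma exists_boundary_bound (hn : 2 ≤ n) {p M D r : ℝ} (hp : (n : ℝ) - 2 < p) (hM : 0 < M)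
    (hD : 0 < D) (hr : 0 < r) :
    ∃ C : ℝ, 0 < C ∧ ∀ (Ω : Set (EuclideanSpace ℝ (Fin n))) (u : EuclideanSpace ℝ (Fin n) → ℝ)
      (S : ℝ) (x₀ y : EuclideanSpace ℝ (Fin n)), 0 < S → IsOpen Ω → Bornology.IsBounded Ω →
      Metric.diam Ω = D → ball y r ⊆ Ω → ContinuousOn u (closure Ω) →
      (∀ x ∈ Ω, ContDiffAt ℝ 2 u x) → ConvexOn ℝ Ω u →
      (∀ x ∈ Ω, hessianDet u x = M * |u x| ^ p) → (∀ x ∈ frontier Ω, u x = 0) →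
      (∀ x ∈ Ω, u x ≤ 0) → (∀ x ∈ Ω, -S ≤ u x) → x₀ ∈ Ω → u x₀ = -S →
      ∀ x ∈ Ω, ∀ z ∈ frontier Ω, -u x ≤ C * S * ‖x - z‖ := by
  have hn2 : (2 : ℝ) ≤ n := by exact_mod_cast hn
  have hn0 : (0 : ℝ) < n := by linarith
  have hp0 : 0 < p := by linarith
  set q : ℝ := min p (n - 1) with hq
  have hq1 : (n : ℝ) - 2 < q := lt_min hp (by linarith)
  have hqn : q < n := (min_le_right _ _).trans_lt (by linarith)
  set δ : ℝ := (q - (n - 2)) / n with hδ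
  have hδ0 : 0 < δ := div_pos (by linarith) hn0
  set R : ℝ := (4 * (1 + δ) ^ 2 * D ^ 2 + 1) / ((1 + δ) * δ) with hR
  have hR0 : 0 < R := by positivity
  set K : ℝ := (D + 1) ^ δ * (R + D ^ 2) + 1 with hK
  have hK0 : 0 < K := by positivity
  set C₀ : ℝ := 2 ^ p * (64 / r ^ 2) ^ n with hC₀
  have hC₀0 : 0 < C₀ := by positivity
  refine ⟨(C₀ * K ^ q) ^ (1 / (n - q)) * K, by positivity, ?_⟩
  intro Ω u S x₀ y hS hΩ hb hdiam hball hcont hsmooth hconv heq hbd hneg hSle hx₀ hux₀ x hx z hz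
  have hMS : M * S ^ p ≤ C₀ * S ^ (n : ℝ) := by
    have h := mul_rpow_le_of_ball_subset hM hp0 hS hΩ hsmooth hconv heq hneg hSle hx₀ hux₀ hr hball
    rw [Real.div_rpow hS.le zero_le_two, ← mul_div_assoc, div_le_iff₀ (by positivity)] at h
    calc M * S ^ p ≤ _ := h
      _ = C₀ * S ^ (n : ℝ) := by
        rw [hC₀, Real.rpow_natCast, mul_div_right_comm, mul_pow]
        ring
  have hzΩ : z ∉ Ω := by
    rw [hΩ.frontier_eq] at hz
    exact hz.2
  obtain ⟨ν, hν, hsupp⟩ := exists_supporting_normal hΩ hconv.1 ⟨x, hx⟩ hzΩ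
  set A := (C₀ * K ^ q) ^ (1 / (n - q)) * S * K with hA
  have hlim : Tendsto (fun ε : ℝ => A * (‖x - z‖ + ε)) (𝓝[>] 0) (𝓝 (A * (‖x - z‖ + 0))) :=
    Tendsto.mono_left (Continuous.tendsto (by fun_prop) 0) nhdsWithin_le_nhds
  have hle : -u x ≤ A * (‖x - z‖ + 0) := by
    refine ge_of_tendsto hlim ?_
    filter_upwards [Ioc_mem_nhdsGT zero_lt_one] with ε hε
    exact neg_le_of_supporting_hyperplane (by omega) hM hS hD hΩ hb hdiam hcont hsmooth heq hbd
      hneg hSle (by linarith) (min_le_left _ _) hqn hδ0 (mul_div_cancel₀ _ hn0.ne') hR0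
      (by rw [hR]; field_simp; rfl) le_rfl hC₀0 hMS (frontier_subset_closure hz) hν hsupp hε.1 hε.2
      x hx
  rw [add_zero] at hle
  exact hle.trans_eq (by rw [hA]; ring)

lemma measurable_hessianMatrix_apply (u : EuclideanSpace ℝ (Fin n) → ℝ) (i j : Fin n) :
    Measurable fun x => hessianMatrix u x i j :=
  measurable_fderiv_apply_const ℝ _ _

lemma lintegral_hessian_le {Ω : Set (EuclideanSpace ℝ (Fin n))} {u : EuclideanSpace ℝ (Fin n) → ℝ}
    {D L : ℝ} (hD : 0 < D) (hΩ : IsOpen Ω) (hb : Bornology.IsBounded Ω)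
    (hdiam : Metric.diam Ω = D) (hsmooth : ∀ x ∈ Ω, ContDiffAt ℝ 2 u x) (hconv : ConvexOn ℝ Ω u)
    (hL : ∀ x ∈ Ω, ∀ e : EuclideanSpace ℝ (Fin n), ‖e‖ = 1 → |fderiv ℝ u x e| ≤ L) :
    ∫⁻ x in Ω, ENNReal.ofReal √(∑ i, ∑ j, hessianMatrix u x i j ^ 2) ≤
      n * (n * (ENNReal.ofReal (2 * L / D) *
        volume (closedBall (0 : EuclideanSpace ℝ (Fin n)) (2 * D)))) := by
  have hpsd : ∀ x ∈ Ω, (hessianMatrix u x).PosSemidef := fun x hx =>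
    posSemidef_hessianMatrix hΩ (hsmooth x hx) hx hconv
  have hdiag : ∀ i, ∫⁻ x in Ω, ENNReal.ofReal (hessianMatrix u x i i) ≤
      ENNReal.ofReal (2 * L / D) * volume (closedBall (0 : EuclideanSpace ℝ (Fin n)) (2 * D)) :=
    fun i => by
      have he : ‖EuclideanSpace.single i (1 : ℝ)‖ = 1 := by simp
      refine lintegral_directional_deriv_le hΩ hb hconv.1 hD hdiam he
        (measurable_fderiv_apply_const ℝ u _) (fun x hx => hL x hx _ he) (fun x hx => ?_)
        fun x hx => (hpsd x hx).diag_nonneg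
      simpa using hasDerivAt_fderiv_comp_line (hsmooth x hx) (EuclideanSpace.single i (1 : ℝ))
  calc ∫⁻ x in Ω, ENNReal.ofReal √(∑ i, ∑ j, hessianMatrix u x i j ^ 2)
      ≤ ∫⁻ x in Ω, n * ∑ i, ENNReal.ofReal (hessianMatrix u x i i) := by
        refine setLIntegral_mono' hΩ.measurableSet fun x hx => ?_
        have h := Matrix.sqrt_sum_sq_le_card_mul_trace (hpsd x hx)
        rw [Fintype.card_fin] at h
        rw [← ENNReal.ofReal_sum_of_nonneg fun i _ => (hpsd x hx).diag_nonneg,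
          ← ENNReal.ofReal_natCast, ← ENNReal.ofReal_mul n.cast_nonneg]
        exact ENNReal.ofReal_le_ofReal h
    _ = n * ∑ i, ∫⁻ x in Ω, ENNReal.ofReal (hessianMatrix u x i i) := by
        have hm := fun i => (measurable_hessianMatrix_apply u i i).ennreal_ofReal
        rw [lintegral_const_mul _ (Finset.measurable_sum _ fun i _ => hm i),
          lintegral_finsetSum _ fun i _ => hm i]
    _ ≤ n * ∑ _i : Fin n, (ENNReal.ofReal (2 * L / D) *
          volume (closedBall (0 : EuclideanSpace ℝ (Fin n)) (2 * D))) := by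
        gcongr with i
        exact hdiag i
    _ = _ := by simp

end HessianIntegral

/-- Global `W^{2,1}` estimate for the Monge–Ampère eigenfunctions:
the Frobenius norm of the Hessian is integrable with the stated bound. -/
theorem stmt_2 (n : ℕ) (hn : 2 ≤ n) (p M V D : ℝ)
    (hp : (n : ℝ) - 2 < p) (hM : 0 < M) (hV : 0 < V) (hD : 0 < D) :
    ∃ C : ℝ, 0 < C ∧
      ∀ (Ω : Set (EuclideanSpace ℝ (Fin n))) (u : EuclideanSpace ℝ (Fin n) → ℝ),
        IsOpen Ω → Bornology.IsBounded Ω → Convex ℝ Ω →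
        volume Ω = ENNReal.ofReal V → Metric.diam Ω = D →
        ContinuousOn u (closure Ω) → ContDiffOn ℝ (⊤ : ℕ∞) u Ω → ConvexOn ℝ Ω u →
        (∃ x ∈ Ω, u x ≠ 0) →
        (∀ x ∈ Ω, hessianDet u x = M * |u x| ^ p) →
        (∀ x ∈ frontier Ω, u x = 0) →
        IntegrableOn (fun x => Real.sqrt (∑ i, ∑ j, (hessianMatrix u x i j) ^ 2)) Ω volume ∧
        ∫ x in Ω, Real.sqrt (∑ i, ∑ j, (hessianMatrix u x i j) ^ 2) ≤
          C * sSup ((fun y => |u y|) '' Ω) := by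
  obtain ⟨r, hr, hin⟩ := exists_ball_subset_of_volume_of_diam (n := n) (by omega) hV hD
  obtain ⟨C₁, hC₁, hbound⟩ := exists_boundary_bound hn hp hM hD hr
  set W := volume (closedBall (0 : EuclideanSpace ℝ (Fin n)) (2 * D)) with hW
  have hWtop : W ≠ ⊤ := measure_closedBall_lt_top.ne
  have hW0 : 0 < W.toReal :=
    ENNReal.toReal_pos (measure_closedBall_pos volume _ (by positivity)).ne' hWtop
  have hn0 : (0 : ℝ) < n := by exact_mod_cast (show 0 < n by omega)
  refine ⟨n * (n * (4 * C₁ / D * W.toReal)), by positivity, ?_⟩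
  intro Ω u hΩ hb hc hvol hdiam hcont hsm hconv hne heq hbd
  have hsmooth : ∀ x ∈ Ω, ContDiffAt ℝ 2 u x := fun x hx =>
    (hsm.contDiffAt (hΩ.mem_nhds hx)).of_le (by norm_cast)
  have hneg := nonpos_of_hessianDet_eq (by omega) hM hΩ hb hcont hsmooth hconv heq hbd
  obtain ⟨x', hx', hux'⟩ := hne
  obtain ⟨x₀, hx₀c, hmax⟩ :=
    hb.isCompact_closure.exists_isMaxOn ⟨x', subset_closure hx'⟩ hcont.abs
  have hle : ∀ x ∈ Ω, |u x| ≤ |u x₀| := fun x hx => hmax (subset_closure hx)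
  have hS : 0 < |u x₀| := (abs_pos.2 hux').trans_le (hle x' hx')
  have hx₀ : x₀ ∈ Ω := by
    by_contra h
    exact abs_pos.1 hS (hbd x₀ (by rw [hΩ.frontier_eq]; exact ⟨hx₀c, h⟩))
  have hsup : sSup ((fun y => |u y|) '' Ω) = |u x₀| :=
    IsGreatest.csSup_eq ⟨⟨x₀, hx₀, rfl⟩, by rintro _ ⟨x, hx, rfl⟩; exact hle x hx⟩
  rw [hsup]
  set S := |u x₀| with hSdef
  obtain ⟨y, hy⟩ := hin Ω hΩ hb hc hvol hdiam
  have hL := hbound Ω u S x₀ y hS hΩ hb hdiam hy hcont hsmooth hconv heq hbd hneg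
    (fun x hx => (abs_le.1 (hle x hx)).1) hx₀ (by rw [hSdef, abs_of_nonpos (hneg x₀ hx₀), neg_neg])
  have hint := lintegral_hessian_le hD hΩ hb hdiam hsmooth hconv fun x hx e he =>
    abs_fderiv_le_of_boundary_bound hΩ hb hdiam hsmooth hconv hneg hL hx he
  have hmeas : Measurable fun x => √(∑ i, ∑ j, hessianMatrix u x i j ^ 2) :=
    (Finset.measurable_sum _ fun i _ => Finset.measurable_sum _ fun j _ =>
      (measurable_hessianMatrix_apply u i j).pow_const 2).sqrt
  have hval : (n : ENNReal) * (n * (ENNReal.ofReal (2 * (2 * (C₁ * S)) / D) * W)) =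
      ENNReal.ofReal (n * (n * (4 * C₁ / D * W.toReal)) * S) := by
    conv_lhs => rw [← ENNReal.ofReal_toReal hWtop]
    rw [← ENNReal.ofReal_natCast, ← ENNReal.ofReal_mul (by positivity),
      ← ENNReal.ofReal_mul (by positivity), ← ENNReal.ofReal_mul (by positivity)]
    congr 1
    ring
  rw [hval] at hint
  refine ⟨⟨hmeas.aestronglyMeasurable, ?_⟩, ?_⟩
  · rw [hasFiniteIntegral_iff_ofReal (ae_of_all _ fun x => Real.sqrt_nonneg _)]
    exact hint.trans_lt ENNReal.ofReal_lt_top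
  · rw [integral_eq_lintegral_of_nonneg_ae (ae_of_all _ fun x => Real.sqrt_nonneg _)
      hmeas.aestronglyMeasurable]
    exact ENNReal.toReal_le_of_le_ofReal (by positivity) hint
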